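/- Let f be an alternating r-linear form on E and let V ⊆ E be an (r+1)-dimensional subspace that is isotropic for f. Then the canonical map Φ : ⋀^r V → (Hom_K(V, E/V))^* is injective if and only if no r-dimensional subspace of V is degenerate for f. -/

import Mathlib

open Module

/-- The decomposable element `v 0 ∧ ⋯ ∧ v (r-1)` of the `r`-th exterior power. -/
noncomputable def wedge {K : Type*} [Field K] {M : Type*} [AddCommGroup M] [Module K M]
    (r : ℕ) (v : Fin r → M) : ⋀[K]^r M :=
  ⟨ExteriorAlgebra.ιMulti K r v, ExteriorAlgebra.ιMulti_range K r (Set.mem_range_self v)⟩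

/-- A subspace `W` is degenerate for an alternating `r`-linear form `f` if
`f(w₁,…,w_{r-1},e) = 0` whenever `w₁,…,w_{r-1} ∈ W` and `e ∈ E` is arbitrary. -/
def IsDegenerateOn {K : Type*} [Field K] {E : Type*} [AddCommGroup E] [Module K E]
    {r : ℕ} (f : AlternatingMap K E K (Fin r)) (W : Submodule K E) : Prop :=
  ∀ w : Fin r → E, (∀ i : Fin r, (i : ℕ) + 1 < r → w i ∈ W) → f w = 0

theorem aux_ext {K : Type*} [Field K] {V N : Type*} [AddCommGroup V] [Module K V]
    [AddCommGroup N] [Module K N] {ι : Type*} {v : ι → V} (hv : LinearIndependent K v)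
    (g : ι → N) : ∃ L : V →ₗ[K] N, ∀ i, L (v i) = g i := by
  obtain ⟨L, hL⟩ := LinearMap.exists_extend ((Basis.span hv).constr K g)
  refine ⟨L, fun i => ?_⟩
  have h1 : ((Basis.span hv) i : V) = v i := by rw [Basis.span_apply]
  have h2 := LinearMap.congr_fun hL (Basis.span hv i)
  rw [Basis.constr_basis] at h2
  rw [← h1]
  exact h2

theorem aux_perm {K : Type*} [Field K] {M N : Type*} [AddCommGroup M] [Module K M]
    [AddCommGroup N] [Module K N] {n : ℕ} (g : M [⋀^Fin n]→ₗ[K] N) (e : Fin n → M)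
    (w : Fin n → Fin n) (hw : Function.Injective w) (h : g e = 0) :
    g (fun i => e (w i)) = 0 := by
  have := g.map_perm e (Equiv.ofBijective w (Finite.injective_iff_bijective.1 hw))
  rw [h, smul_zero] at this
  exact this

theorem aux_scalar {K : Type*} [Field K] {M N : Type*} [AddCommGroup M] [Module K M]
    [AddCommGroup N] [Module K N] {n : ℕ} (g : M [⋀^Fin n]→ₗ[K] N)
    (W : Submodule K M) [FiniteDimensional K W] (hW : finrank K W = n)
    (e : Fin n → W) (he : LinearIndependent K e) (v : Fin n → W) :
    ∃ c : K, g (fun i => (v i : M)) = c • g (fun i => (e i : M)) := by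
  let b : Basis (Fin n) K W := basisOfLinearIndependentOfCardEqFinrank' e he (by simp [hW])
  have hb : ∀ i, b i = e i := fun i => by simp [b]
  refine ⟨b.det v, ?_⟩
  have key : g.compLinearMap W.subtype - 
      (LinearMap.toSpanSingleton K N (g (fun i => (e i : M)))).compAlternatingMap b.det = 0 := by
    refine Basis.ext_alternating b fun w hw => ?_
    apply aux_perm _ _ _ hw
    simp [hb, b.det_self]
  have := congrArg (fun q => q v) key
  simp [sub_eq_zero] at this
  exact this

theorem aux_add {K : Type*} [Field K] {M N : Type*} [AddCommGroup M] [Module K M]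
    [AddCommGroup N] [Module K N] {s : ℕ} (hM : finrank K M = s + 2)
    (g : M [⋀^Fin (s+1)]→ₗ[K] N) (v w : Fin (s+1) → M) : ∃ z, g z = g v + g w := by
  have : FiniteDimensional K M := FiniteDimensional.of_finrank_pos (by omega)
  by_cases hv : LinearIndependent K v
  swap
  · exact ⟨w, by rw [g.map_linearDependent v hv, zero_add]⟩
  by_cases hw : LinearIndependent K w
  swap
  · exact ⟨v, by rw [g.map_linearDependent w hw, add_zero]⟩
  set A := Submodule.span K (Set.range v) with hA
  set B := Submodule.span K (Set.range w) with hB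
  have dA : finrank K A = s + 1 := by rw [hA, finrank_span_eq_card hv]; simp
  have dB : finrank K B = s + 1 := by rw [hB, finrank_span_eq_card hw]; simp
  have h1 := Submodule.finrank_sup_add_finrank_inf_eq A B
  have h2 := Submodule.finrank_le (A ⊔ B)
  obtain ⟨u, hu⟩ := exists_linearIndependent_of_le_finrank
    (show s ≤ finrank K (A ⊓ B : Submodule K M) by omega)
  have ext : ∀ (C : Submodule K M) (hC : finrank K C = s + 1) (hle : A ⊓ B ≤ C)
      (y : Fin (s+1) → M) (hy : ∀ i, y i ∈ C),
      ∃ p : M, g y = g (Fin.cons p (fun i => (u i : M)) : Fin (s+1) → M) := by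
    intro C hC hle y hy
    have hu' : LinearIndependent K (fun i => Submodule.inclusion hle (u i)) :=
      hu.map' (Submodule.inclusion hle) (Submodule.ker_inclusion _ _ hle)
    obtain ⟨p, hp⟩ := exists_linearIndependent_cons_of_lt_finrank hu' (by omega)
    obtain ⟨c, hc⟩ := aux_scalar g C hC _ hp (fun i => ⟨y i, hy i⟩)
    refine ⟨c • (p : M), ?_⟩
    have e1 : (fun i => ((Fin.cons p (fun i => Submodule.inclusion hle (u i)) : Fin (s+1) → C) i : M))
      = (Fin.cons (p : M) (fun i => (u i : M)) : Fin (s+1) → M) := by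
      funext i
      refine Fin.cases ?_ (fun j => ?_) i <;> simp
    rw [e1] at hc
    have e2 := g.map_update_smul (Fin.cons (p : M) (fun i => (u i : M)) : Fin (s+1) → M) 0 c p
    simp only [Fin.update_cons_zero] at e2
    rw [e2, ← hc]
  obtain ⟨p, hp⟩ := ext A dA inf_le_left v (fun i => Submodule.subset_span ⟨i, rfl⟩)
  obtain ⟨q, hq⟩ := ext B dB inf_le_right w (fun i => Submodule.subset_span ⟨i, rfl⟩)
  refine ⟨Fin.cons (p + q) (fun i => (u i : M)), ?_⟩
  have e2 := g.map_update_add (Fin.cons (p : M) (fun i => (u i : M)) : Fin (s+1) → M) 0 p q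
  simp only [Fin.update_cons_zero] at e2
  rw [e2, hp, hq]

theorem aux_decomp {K : Type*} [Field K] {M : Type*} [AddCommGroup M] [Module K M]
    {s : ℕ} (hM : finrank K M = s + 2) (x : ⋀[K]^(s+1) M) : ∃ z, x = wedge (s+1) z := by
  obtain ⟨x, hx'⟩ := x
  have hx := hx'
  rw [← ExteriorAlgebra.ιMulti_span_fixedDegree] at hx
  suffices h : ∃ z, ExteriorAlgebra.ιMulti K (s+1) z = x by
    obtain ⟨z, hz⟩ := h
    exact ⟨z, Subtype.ext hz.symm⟩
  clear hx'
  induction hx using Submodule.span_induction with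
  | mem x h => exact h
  | zero => exact ⟨0, AlternatingMap.map_zero _⟩
  | add x y _ _ hx hy =>
    obtain ⟨v, rfl⟩ := hx
    obtain ⟨w, rfl⟩ := hy
    exact aux_add hM _ v w
  | smul c x _ hx =>
    obtain ⟨v, rfl⟩ := hx
    refine ⟨Function.update v 0 (c • v 0), ?_⟩
    rw [AlternatingMap.map_update_smul, Function.update_eq_self]

theorem aux_ne {K : Type*} [Field K] {M : Type*} [AddCommGroup M] [Module K M]
    {r : ℕ} (v : Fin r → M) (hv : LinearIndependent K v) : wedge (K := K) r v ≠ 0 := by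
  obtain ⟨L, hL⟩ := aux_ext hv (fun i => Pi.basisFun K (Fin r) i)
  intro h
  have h1 : exteriorPower.ιMulti K r v = 0 := h
  have h2 := exteriorPower.alternatingMapLinearEquiv_apply_ιMulti
    ((Pi.basisFun K (Fin r)).det.compLinearMap L) v
  rw [h1, map_zero] at h2
  have h3 : (fun i => L (v i)) = Pi.basisFun K (Fin r) := funext hL
  rw [AlternatingMap.compLinearMap_apply] at h2
  change 0 = (Pi.basisFun K (Fin r)).det (fun i => L (v i)) at h2
  rw [h3, Basis.det_self] at h2
  exact zero_ne_one h2

/-- Let `f` be an alternating `r`-linear form on `E` and let `V ⊆ E` be an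
`(r+1)`-dimensional subspace isotropic for `f`.  Then the canonical map
`Φ : ⋀^r V → Hom(V, E/V)*` is injective if and only if no `r`-dimensional subspace of `V`
is degenerate for `f`. -/
theorem stmt_1 {K : Type*} [Field K] {E : Type*} [AddCommGroup E] [Module K E]
    (r : ℕ) (hr : 1 ≤ r)
    (f : AlternatingMap K E K (Fin r))
    (V : Submodule K E) (hV : finrank K V = r + 1)
    (hiso : ∀ v : Fin r → V, f (fun l => (v l : E)) = 0)
    (Φ : (⋀[K]^r V : Submodule K (ExteriorAlgebra K V)) →ₗ[K] Module.Dual K (V →ₗ[K] E ⧸ V))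
    (hΦ : ∀ (φ : V →ₗ[K] E ⧸ V) (φl : V →ₗ[K] E), (∀ v : V, V.mkQ (φl v) = φ v) →
      ∀ v : Fin r → V,
        Φ (wedge r v) φ =
          ∑ j : Fin r, f (Function.update (fun l => (v l : E)) j (φl (v j)))) :
    Function.Injective Φ ↔
      ¬ ∃ W : Submodule K E, W ≤ V ∧ finrank K W = r ∧ IsDegenerateOn f W := by
  obtain ⟨s, rfl⟩ : ∃ s, r = s + 1 := ⟨r - 1, by omega⟩
  have hfin : FiniteDimensional K V := FiniteDimensional.of_finrank_pos (by omega)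
  constructor
  · rintro hinj ⟨W, hWV, hWr, hdeg⟩
    have : FiniteDimensional K W := FiniteDimensional.of_finrank_pos (by omega)
    let b : Basis (Fin (s+1)) K W := finBasisOfFinrankEq K W hWr
    let v : Fin (s+1) → V := fun i => Submodule.inclusion hWV (b i)
    have hv : LinearIndependent K v :=
      b.linearIndependent.map' (Submodule.inclusion hWV) (Submodule.ker_inclusion _ _ hWV)
    apply aux_ne v hv
    apply hinj
    rw [map_zero]
    ext φ
    obtain ⟨φl, hφ⟩ := Module.projective_lifting_property V.mkQ φ V.mkQ_surjective
    rw [hΦ φ φl (fun v => LinearMap.congr_fun hφ v) v]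
    refine Finset.sum_eq_zero fun j _ => ?_
    set w := Function.update (fun l => (v l : E)) j (φl (v j)) with hw
    have h0 : f (w ∘ Equiv.swap j (Fin.last s)) = 0 := by
      apply hdeg
      intro i hi
      have hne : Equiv.swap j (Fin.last s) i ≠ j := by
        intro h
        have h' : i = Fin.last s := by
          rw [Equiv.swap_apply_eq_iff, Equiv.swap_apply_left] at h
          exact h
        rw [h'] at hi
        simp at hi
      simp only [Function.comp, hw, Function.update_of_ne hne]
      exact (b _).2
    rw [f.map_perm] at h0
    exact (smul_eq_zero_iff_eq _).1 h0
  · intro hno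
    rw [injective_iff_map_eq_zero]
    intro x hx
    by_contra hx0
    obtain ⟨v, rfl⟩ := aux_decomp hV x
    have hv : LinearIndependent K v := by
      by_contra hv
      exact hx0 (Subtype.ext (AlternatingMap.map_linearDependent _ v hv))
    have hv' : LinearIndependent K (fun i => (v i : E)) :=
      hv.map' V.subtype V.ker_subtype
    have hz : ∀ j e, f (Function.update (fun l => (v l : E)) j e) = 0 := by
      intro j e
      obtain ⟨φl, hφ⟩ := aux_ext hv (Function.update (0 : Fin (s+1) → E) j e)
      have h := hΦ (V.mkQ ∘ₗ φl) φl (fun _ => rfl) v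
      rw [hx, Finset.sum_eq_single j] at h
      · rw [hφ, Function.update_self] at h
        exact h.symm
      · intro i _ hij
        rw [hφ, Function.update_of_ne hij]
        exact f.map_update_zero _ _
      · simp
    apply hno
    refine ⟨Submodule.span K (Set.range fun i => (v i : E)), ?_, ?_, ?_⟩
    · rw [Submodule.span_le]
      rintro _ ⟨i, rfl⟩
      exact (v i).2
    · rw [finrank_span_eq_card hv']; simp
    · intro w hw
      have key : ∀ e : E, (f.curryLeft e).compLinearMap
          (Submodule.span K (Set.range fun i => (v i : E))).subtype = 0 := by
        intro e
        refine Basis.ext_alternating (Basis.span hv') fun t ht => ?_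
        obtain ⟨j, hj⟩ : ∃ j, j ∉ Set.range t := by
          by_contra! h
          have := Fintype.card_le_of_surjective t h
          simp at this
        have h := aux_perm f _ (Fin.cons j t) (Fin.cons_injective_iff.2 ⟨hj, ht⟩) (hz j e)
        rw [AlternatingMap.compLinearMap_apply, AlternatingMap.curryLeft_apply_apply,
          AlternatingMap.zero_apply, ← h]
        congr 1
        funext i
        refine Fin.cases ?_ (fun k => ?_) i
        · simp
        · have : t k ≠ j := fun h => hj ⟨k, h⟩
          simp [Function.update_of_ne this, Basis.span_apply]
      have h1 := congrArg (fun q => q (fun i : Fin s => ⟨w i.castSucc, hw i.castSucc (by simp)⟩))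
        (key (w (Fin.last s)))
      have h2 : f (Fin.cons (w (Fin.last s)) (fun i : Fin s => w i.castSucc) : Fin (s+1) → E) = 0 := h1
      have h3 : (Fin.cons (w (Fin.last s)) (fun i : Fin s => w i.castSucc) : Fin (s+1) → E)
          = w ∘ (finRotate (s+1)).symm := by
        rw [Equiv.eq_comp_symm]
        funext i
        refine Fin.lastCases ?_ (fun k => ?_) i
        · simp
        · simp
      rw [h3, f.map_perm] at h2
      exact (smul_eq_zero_iff_eq _).1 h2
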